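/- (Strong completeness of the product-free, constant-free fragment w.r.t. standard models.) If a sequent Π → B in the language of \, /, ∧ (no product, no constants) semantically follows from a set H of sequents in this language over the class of square R-models (i.e. Π → B is true in every square R-model in which all sequents of H are true), then Π → B is derivable from H in L^Λ_{\,/}(∧). -/

import Mathlib

/-- Formulae in the language of `\`, `/`, and `∧` (no product, no constants). -/
inductive Fm where
  | var : ℕ → Fm                -- propositional variable
  | ldiv : Fm → Fm → Fm         -- left division A\B
  | rdiv : Fm → Fm → Fm         -- right division B/A
  | inter : Fm → Fm → Fm        -- intersection A∧B

/-- Derivability from hypotheses `H` in the product-free, constant-free calculus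
`L^Λ_{\,/}(∧)`. -/
inductive Deriv (H : Set (List Fm × Fm)) : List Fm → Fm → Prop
  | hyp {P B} : (P, B) ∈ H → Deriv H P B
  | id (A) : Deriv H [A] A
  | cut {P A Γ Δ C} : Deriv H P A → Deriv H (Γ ++ [A] ++ Δ) C →
      Deriv H (Γ ++ P ++ Δ) C
  | ldivL {P A Γ B Δ C} : Deriv H P A → Deriv H (Γ ++ [B] ++ Δ) C →
      Deriv H (Γ ++ P ++ [Fm.ldiv A B] ++ Δ) C
  | ldivR {P A B} : Deriv H (A :: P) B → Deriv H P (Fm.ldiv A B)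
  | rdivL {P A Γ B Δ C} : Deriv H P A → Deriv H (Γ ++ [B] ++ Δ) C →
      Deriv H (Γ ++ [Fm.rdiv B A] ++ P ++ Δ) C
  | rdivR {P A B} : Deriv H (P ++ [A]) B → Deriv H P (Fm.rdiv B A)
  | andL1 {Γ A B Δ C} : Deriv H (Γ ++ [A] ++ Δ) C →
      Deriv H (Γ ++ [Fm.inter A B] ++ Δ) C
  | andL2 {Γ A B Δ C} : Deriv H (Γ ++ [B] ++ Δ) C →
      Deriv H (Γ ++ [Fm.inter A B] ++ Δ) C
  | andR {P A B} : Deriv H P A → Deriv H P B → Deriv H P (Fm.inter A B)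

/-- Relational composition of binary relations on `W`. -/
def rcomp {W : Type} (R S : Set (W × W)) : Set (W × W) :=
  {p | ∃ y, (p.1, y) ∈ R ∧ (y, p.2) ∈ S}

/-- Left residual `R \ S`. -/
def lres {W : Type} (R S : Set (W × W)) : Set (W × W) :=
  {p | ∀ x, (x, p.1) ∈ R → (x, p.2) ∈ S}

/-- Right residual `S / R`. -/
def rres {W : Type} (S R : Set (W × W)) : Set (W × W) :=
  {p | ∀ z, (p.2, z) ∈ R → (p.1, z) ∈ S}

/-- The diagonal relation `δ`. -/
def diag {W : Type} : Set (W × W) := {p | p.1 = p.2}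

/-- A square R-model over a (non-empty) set `W`. -/
structure SqModel (W : Type) where
  v : Fm → Set (W × W)
  v_ldiv : ∀ A B, v (Fm.ldiv A B) = lres (v A) (v B)
  v_rdiv : ∀ B A, v (Fm.rdiv B A) = rres (v B) (v A)
  v_inter : ∀ A B, v (Fm.inter A B) = v A ∩ v B

/-- Interpretation of an antecedent: `v(A₁)∘…∘v(Aₙ)`, with `δ` for the empty list. -/
def SqModel.vList {W : Type} (M : SqModel W) : List Fm → Set (W × W)
  | [] => diag
  | A :: Γ => rcomp (M.v A) (M.vList Γ)

/-- Truth of a sequent in a square R-model. -/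
def SqModel.seqTrue {W : Type} (M : SqModel W) (s : List Fm × Fm) : Prop :=
  M.vList s.1 ⊆ M.v s.2

namespace FreeGroup

variable {α : Type*}

/-- The canonical embedding of the free monoid into the free group. -/
def ofList (w : List α) : FreeGroup α := mk (w.map fun a => (a, true))

@[simp] theorem ofList_nil : ofList ([] : List α) = 1 := rfl

@[simp] theorem ofList_append (u w : List α) : ofList (u ++ w) = ofList u * ofList w := by
  simp [ofList]

theorem isReduced_map_true : ∀ w : List α, IsReduced (w.map fun a => (a, true))
  | [] => .nil
  | [_] => .singleton
  | _ :: b :: w => isReduced_cons_cons.2 ⟨fun _ => rfl, isReduced_map_true (b :: w)⟩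

theorem IsReduced.eq_of_mk_eq {L₁ L₂ : List (α × Bool)} (h₁ : IsReduced L₁) (h₂ : IsReduced L₂)
    (h : mk L₁ = mk L₂) : L₁ = L₂ := by
  classical
  rw [← h₁.reduce_eq, ← h₂.reduce_eq, ← toWord_mk, ← toWord_mk, h]

theorem ofList_injective : Function.Injective (ofList : List α → FreeGroup α) := fun u w h =>
  List.map_injective_iff.2 (fun _ _ h => congrArg Prod.fst h)
    ((isReduced_map_true u).eq_of_mk_eq (isReduced_map_true w) h)

theorem exists_isReduced_mk_eq (g : FreeGroup α) : ∃ L, IsReduced L ∧ mk L = g := by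
  classical
  exact ⟨g.toWord, isReduced_toWord, mk_toWord⟩

theorem IsReduced.mem_range_or_cons {L : List (α × Bool)} (hL : IsReduced L) {a : α} {u : List α}
    (h : ofList [a] * mk L = ofList u) :
    mk L ∈ Set.range (ofList (α := α)) ∨ ∃ L', L = (a, false) :: L' := by
  by_cases hr : IsReduced ((a, true) :: L)
  · have := hr.eq_of_mk_eq (isReduced_map_true u) h
    cases u with
    | nil => simp at this
    | cons b u =>
      simp only [List.map_cons, List.cons.injEq] at this
      exact .inl ⟨u, by rw [this.2, ofList]⟩
  · rcases L with _ | ⟨⟨b, _ | _⟩, L⟩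
    · exact absurd .singleton hr
    · rw [isReduced_cons_cons] at hr
      have : a = b := by_contra fun hab => hr ⟨fun e => absurd e hab, hL⟩
      exact .inr ⟨L, by rw [this]⟩
    · exact (hr (isReduced_cons_cons.2 ⟨fun _ => rfl, hL⟩)).elim

theorem IsReduced.mem_range_or_concat {L : List (α × Bool)} (hL : IsReduced L) {a : α}
    {u : List α} (h : mk L * ofList [a] = ofList u) :
    mk L ∈ Set.range (ofList (α := α)) ∨ ∃ L', L = L' ++ [(a, false)] := by
  by_cases hr : IsReduced (L ++ [(a, true)])
  · have h' := hr.eq_of_mk_eq (isReduced_map_true u) h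
    rcases List.eq_nil_or_concat' u with rfl | ⟨u, b, rfl⟩
    · simp at h'
    · rw [List.map_append] at h'
      exact .inl ⟨u, by rw [(List.append_inj' h' rfl).1, ofList]⟩
  · rcases List.eq_nil_or_concat' L with rfl | ⟨L, ⟨b, c⟩, rfl⟩
    · exact absurd .singleton hr
    · have : b = a ∧ c = false := by
        by_contra hbc
        refine hr ?_
        have hab : IsReduced ([(b, c)] ++ [(a, true)]) :=
          isReduced_cons_cons.2 ⟨fun e => by simpa [show b = a from e] using hbc, .singleton⟩
        exact hL.append_overlap hab (by simp)
      exact .inr ⟨L, by rw [this.1, this.2]⟩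

theorem mem_range_ofList_of_mul_left {a b : α} (hab : a ≠ b) {g : FreeGroup α} {u w : List α}
    (ha : ofList [a] * g = ofList u) (hb : ofList [b] * g = ofList w) :
    g ∈ Set.range (ofList (α := α)) := by
  obtain ⟨L, hL, rfl⟩ := exists_isReduced_mk_eq g
  rcases hL.mem_range_or_cons ha with h | ⟨L₁, h₁⟩
  · exact h
  rcases hL.mem_range_or_cons hb with h | ⟨L₂, h₂⟩
  · exact h
  rw [h₁] at h₂
  exact absurd (by simpa using congrArg List.head? h₂) hab

theorem mem_range_ofList_of_mul_right {a b : α} (hab : a ≠ b) {g : FreeGroup α} {u w : List α}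
    (ha : g * ofList [a] = ofList u) (hb : g * ofList [b] = ofList w) :
    g ∈ Set.range (ofList (α := α)) := by
  obtain ⟨L, hL, rfl⟩ := exists_isReduced_mk_eq g
  rcases hL.mem_range_or_concat ha with h | ⟨L₁, h₁⟩
  · exact h
  rcases hL.mem_range_or_concat hb with h | ⟨L₂, h₂⟩
  · exact h
  rw [h₁] at h₂
  exact absurd (by simpa using congrArg List.getLast? h₂) hab

end FreeGroup

theorem Fm.ne_inter_self (A : Fm) : A ≠ A.inter A := fun h => by
  have := congrArg sizeOf h
  simp at this

namespace Deriv

variable {H : Set (List Fm × Fm)}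

theorem inter_self (A : Fm) : Deriv H [A.inter A] A :=
  andL1 (Γ := []) (Δ := []) (id A)

theorem ldiv_iff {w : List Fm} {A B : Fm} :
    Deriv H w (A.ldiv B) ↔ ∀ u, Deriv H u A → Deriv H (u ++ w) B := by
  refine ⟨fun h u hu => ?_, fun h => ldivR (h [A] (id A))⟩
  have : Deriv H (u ++ [A.ldiv B]) B := by
    simpa using ldivL (Γ := []) (Δ := []) hu (id B)
  simpa using cut (Γ := u) (Δ := []) h (by simpa using this)

theorem rdiv_iff {w : List Fm} {A B : Fm} :
    Deriv H w (B.rdiv A) ↔ ∀ u, Deriv H u A → Deriv H (w ++ u) B := by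
  refine ⟨fun h u hu => ?_, fun h => rdivR (h [A] (id A))⟩
  have : Deriv H (B.rdiv A :: u) B := by
    simpa using rdivL (Γ := []) (Δ := []) hu (id B)
  simpa using cut (Γ := []) (Δ := u) h (by simpa using this)

theorem inter_iff {w : List Fm} {A B : Fm} :
    Deriv H w (A.inter B) ↔ Deriv H w A ∧ Deriv H w B := by
  refine ⟨fun h => ⟨?_, ?_⟩, fun h => andR h.1 h.2⟩
  · simpa using cut (Γ := []) (Δ := []) h (andL1 (id A))
  · simpa using cut (Γ := []) (Δ := []) h (andL2 (id B))

end Deriv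

open FreeGroup in
/-- The canonical square R-model on the free group generated by all formulae. -/
def freeGroupModel (H : Set (List Fm × Fm)) : SqModel (FreeGroup Fm) where
  v A := {p | ∃ w, Deriv H w A ∧ p.1 * ofList w = p.2}
  v_ldiv A B := by
    ext ⟨y, z⟩
    simp only [lres, Set.mem_ofPred_eq]
    constructor
    · rintro ⟨w, hw, rfl⟩ _ ⟨u, hu, rfl⟩
      exact ⟨u ++ w, Deriv.ldiv_iff.1 hw u hu, by simp [mul_assoc]⟩
    · intro h
      have key : ∀ u, Deriv H u A → ∃ w, Deriv H w B ∧ ofList u * (y⁻¹ * z) = ofList w := by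
        intro u hu
        obtain ⟨w, hw, rfl⟩ := h (y * (ofList u)⁻¹) ⟨u, hu, by simp⟩
        exact ⟨w, hw, by group⟩
      obtain ⟨_, -, h₁⟩ := key _ (.id A)
      obtain ⟨_, -, h₂⟩ := key _ (.inter_self A)
      obtain ⟨w, hw⟩ := mem_range_ofList_of_mul_left A.ne_inter_self h₁ h₂
      refine ⟨w, Deriv.ldiv_iff.2 fun u hu => ?_, by rw [hw]; group⟩
      obtain ⟨w', hw', e⟩ := key u hu
      rw [← hw, ← ofList_append] at e
      rwa [ofList_injective e]
  v_rdiv B A := by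
    ext ⟨x, y⟩
    simp only [rres, Set.mem_ofPred_eq]
    constructor
    · rintro ⟨w, hw, rfl⟩ _ ⟨u, hu, rfl⟩
      exact ⟨w ++ u, Deriv.rdiv_iff.1 hw u hu, by simp [mul_assoc]⟩
    · intro h
      have key : ∀ u, Deriv H u A → ∃ w, Deriv H w B ∧ x⁻¹ * y * ofList u = ofList w := by
        intro u hu
        obtain ⟨w, hw, e⟩ := h (y * ofList u) ⟨u, hu, rfl⟩
        exact ⟨w, hw, by rw [mul_assoc, ← e]; group⟩
      obtain ⟨_, -, h₁⟩ := key _ (.id A)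
      obtain ⟨_, -, h₂⟩ := key _ (.inter_self A)
      obtain ⟨w, hw⟩ := mem_range_ofList_of_mul_right A.ne_inter_self h₁ h₂
      refine ⟨w, Deriv.rdiv_iff.2 fun u hu => ?_, by rw [hw]; group⟩
      obtain ⟨w', hw', e⟩ := key u hu
      rw [← hw, ← ofList_append] at e
      rwa [ofList_injective e]
  v_inter A B := by
    ext ⟨x, y⟩
    constructor
    · rintro ⟨w, hw, e⟩
      exact ⟨⟨w, (Deriv.inter_iff.1 hw).1, e⟩, ⟨w, (Deriv.inter_iff.1 hw).2, e⟩⟩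
    · rintro ⟨⟨w, hw, e⟩, ⟨w', hw', e'⟩⟩
      obtain rfl := ofList_injective (mul_left_cancel (e.trans e'.symm))
      exact ⟨w, Deriv.inter_iff.2 ⟨hw, hw'⟩, e⟩

open FreeGroup in
theorem freeGroupModel_mem_vList (H : Set (List Fm × Fm)) (x : FreeGroup Fm) (P : List Fm) :
    (x, x * ofList P) ∈ (freeGroupModel H).vList P := by
  induction P generalizing x with
  | nil => simp [SqModel.vList, diag]
  | cons A P ih =>
    refine ⟨x * ofList [A], ⟨[A], .id A, rfl⟩, ?_⟩
    have := ih (x * ofList [A])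
    rwa [mul_assoc, ← ofList_append] at this

open FreeGroup in
theorem exists_deriv_of_mem_vList {H : Set (List Fm × Fm)} {Γ P : List Fm} {B : Fm}
    (h : Deriv H (Γ ++ P) B) {x y : FreeGroup Fm} (hxy : (x, y) ∈ (freeGroupModel H).vList P) :
    ∃ w, Deriv H (Γ ++ w) B ∧ x * ofList w = y := by
  induction P generalizing Γ x with
  | nil => exact ⟨[], h, by simpa [SqModel.vList, diag] using hxy⟩
  | cons A P ih =>
    obtain ⟨z, ⟨u, hu, hz : x * FreeGroup.ofList u = z⟩, hP⟩ := hxy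
    subst hz
    obtain ⟨w, hw, e⟩ := ih (.cut (Γ := Γ) hu (by simpa using h)) hP
    exact ⟨u ++ w, by simpa using hw, by simpa [mul_assoc] using e⟩

/-- Strong completeness of the product-free, constant-free fragment w.r.t. square
R-models: if `Π → B` is true in every square R-model in which all sequents of `H` are
true, then `Π → B` is derivable from `H` in `L^Λ_{\,/}(∧)`. -/
theorem strong_completeness_pf_cf (H : Set (List Fm × Fm)) (P : List Fm) (B : Fm)
    (h : ∀ (W : Type) [Nonempty W] (M : SqModel W),
      (∀ s ∈ H, M.seqTrue s) → M.seqTrue (P, B)) :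
    Deriv H P B := by
  obtain ⟨w, hw, e⟩ := h (FreeGroup Fm) (freeGroupModel H)
    (fun s hs p hp => exists_deriv_of_mem_vList (Γ := []) (.hyp hs) hp)
    (freeGroupModel_mem_vList H 1 P)
  rwa [← FreeGroup.ofList_injective (mul_left_cancel e)]
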